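/- arXiv:0710.1816 — 3 statements merged into one kernel-verified Lean document; each statement's English description precedes it below -/
import Mathlib

section
/- Let G be an abelian group, let α, β ∈ G, and let λ and π be nonempty set partitions (of [n] and [n'] respectively). If the multisets s_{α,β}(T(λ,l)) and s_{α,β}(T(π,l)) are equal for l = 0 and l = 1, then the multisets s_{α,β}(T(λ,l,m)) and s_{α,β}(T(π,l,m)) are equal for all l, m ≥ 0. -/
open Finset

/-- A set partition of `[n] = {1,…,n}`, modeled as a `Finpartition` of `Fin n`. -/
abbrev SetPartition (n : ℕ) := Finpartition (Finset.univ : Finset (Fin n))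

/-- `(i,j)` is an arc of the partition `p`: `i < j`, they lie in a common block,
and no element of that block lies strictly between them. -/
def IsArc {n : ℕ} (p : SetPartition n) (i j : Fin n) : Prop :=
  i < j ∧ ∃ B ∈ p.parts, i ∈ B ∧ j ∈ B ∧ ∀ x ∈ B, ¬ (i < x ∧ x < j)

/-- Arcs `a = (i₁,j₁)` and `b = (i₂,j₂)` form a crossing: `i₁ < i₂ < j₁ < j₂`. -/
def Crossing {n : ℕ} (a b : Fin n × Fin n) : Prop :=
  a.1 < b.1 ∧ b.1 < a.2 ∧ a.2 < b.2

/-- Arcs `a = (i₁,j₁)` and `b = (i₂,j₂)` form a nesting: `i₁ < i₂ < j₂ < j₁`. -/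
def Nesting {n : ℕ} (a b : Fin n × Fin n) : Prop :=
  a.1 < b.1 ∧ b.1 < b.2 ∧ b.2 < a.2

/-- `cr p`: the number of crossings of two arcs in `p`. -/
noncomputable def cr {n : ℕ} (p : SetPartition n) : ℕ :=
  {e : (Fin n × Fin n) × (Fin n × Fin n) |
    IsArc p e.1.1 e.1.2 ∧ IsArc p e.2.1 e.2.2 ∧ Crossing e.1 e.2}.ncard

/-- `ne' p`: the number of nestings of two arcs in `p`. -/
noncomputable def ne' {n : ℕ} (p : SetPartition n) : ℕ :=
  {e : (Fin n × Fin n) × (Fin n × Fin n) |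
    IsArc p e.1.1 e.1.2 ∧ IsArc p e.2.1 e.2.2 ∧ Nesting e.1 e.2}.ncard

/-- `al p`: the number of alignments (unordered pairs of arcs that neither
cross nor nest, counted with first endpoints in increasing order). -/
noncomputable def al {n : ℕ} (p : SetPartition n) : ℕ :=
  {e : (Fin n × Fin n) × (Fin n × Fin n) |
    IsArc p e.1.1 e.1.2 ∧ IsArc p e.2.1 e.2.2 ∧ e.1.1 < e.2.1 ∧
    ¬ Crossing e.1 e.2 ∧ ¬ Crossing e.2 e.1 ∧
    ¬ Nesting e.1 e.2 ∧ ¬ Nesting e.2 e.1}.ncard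

/-- `i` and `j` lie in a common block of `p`. -/
def InSameBlock {n : ℕ} (p : SetPartition n) (i j : Fin n) : Prop :=
  ∃ B ∈ p.parts, i ∈ B ∧ j ∈ B

/-- `c` (a partition of `[n+1]`) is a child of `p` (a partition of `[n]`):
deleting the element `1` from `c` and shifting down by one yields `p`. -/
def IsChild {n : ℕ} (c : SetPartition (n + 1)) (p : SetPartition n) : Prop :=
  ∀ i j : Fin n, (InSameBlock p i j ↔ InSameBlock c i.succ j.succ)

/-- `level p l` is `T(p, l)`: the set of partitions of `[n+l]` at the `l`-th level of
the subtree rooted at `p` in the tree of partitions. -/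
def level {n : ℕ} (p : SetPartition n) : (l : ℕ) → Set (SetPartition (n + l))
  | 0 => {p}
  | l + 1 => {c | ∃ q ∈ level p l, IsChild c q}

/-- The statistic `s_{α,β}(p) = cr(p)·α + ne(p)·β`. -/
noncomputable def statS {G : Type*} [AddCommGroup G] (α β : G) {n : ℕ} (p : SetPartition n) : G :=
  cr p • α + ne' p • β



/-! ### The `(a, b)`-derivative of polynomials -/

section PQDeriv

open Polynomial

variable {R : Type*} [CommSemiring R] (a b : R)

/-- The image of `X ^ r` under the `(a, b)`-derivative. -/
noncomputable def pqDerivPow : ℕ → R[X]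
  | 0 => 0
  | r + 1 => C (b ^ r) * X ^ r + C a * X * pqDerivPow r

/-- The `(a, b)`-derivative, sending `X ^ (r + 1)` to
`(a ^ r + a ^ (r - 1) b + ⋯ + b ^ r) X ^ r`. -/
noncomputable def pqDeriv : R[X] →ₗ[R] R[X] :=
  (Polynomial.basisMonomials R).constr R (pqDerivPow a b)

lemma pqDeriv_monomial_one (r : ℕ) : pqDeriv a b (monomial r 1) = pqDerivPow a b r := by
  have := (Polynomial.basisMonomials R).constr_basis R (pqDerivPow a b) r
  rwa [coe_basisMonomials] at this

lemma pqDeriv_one : pqDeriv a b 1 = 0 :=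
  pqDeriv_monomial_one a b 0

lemma pqDeriv_X_mul (Q : R[X]) :
    pqDeriv a b (X * Q) = Q.comp (C b * X) + C a * X * pqDeriv a b Q := by
  induction Q using Polynomial.induction_on' with
  | add P Q hP hQ => simp only [mul_add, map_add, add_comp, hP, hQ]; ring
  | monomial r c =>
    have h (k : ℕ) : monomial k c = c • (monomial k 1 : R[X]) := by simp [smul_monomial]
    rw [X_mul_monomial, h, h r]
    simp only [map_smul, pqDeriv_monomial_one, pqDerivPow, smul_comp, monomial_comp, C_1, one_mul,
      mul_pow, C_pow, smul_add, mul_smul_comm]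

lemma pqDeriv_prod {ι : Type*} [LinearOrder ι] (M : Finset ι) (x : ι → R) :
    pqDeriv a b (∏ m ∈ M, (1 + C (x m) * X)) =
      ∑ m ∈ M, C (x m) *
        ∏ j ∈ M.erase m, (1 + C (x j * if j < m then a else b) * X) := by
  induction M using Finset.induction_on_min with
  | empty => simp [pqDeriv_one]
  | insert i M hi ih =>
    have hiM : i ∉ M := fun h => lt_irrefl _ (hi i h)
    have hne : ∀ m ∈ M, i ≠ m := fun m hm h => hiM (h ▸ hm)
    rw [prod_insert hiM, sum_insert hiM, erase_insert hiM, add_mul, one_mul, map_add, mul_assoc,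
      ← smul_eq_C_mul, map_smul, pqDeriv_X_mul, smul_eq_C_mul, ih, Polynomial.prod_comp]
    have h₁ : ∏ j ∈ M, (1 + C (x j * if j < i then a else b) * X) =
        ∏ j ∈ M, (1 + C (x j) * X).comp (C b * X) := by
      refine prod_congr rfl fun j hj => ?_
      rw [if_neg (hi j hj).not_gt]
      simp [mul_assoc]
    have h₂ : ∀ m ∈ M, C (x m) * ∏ j ∈ (insert i M).erase m,
          (1 + C (x j * if j < m then a else b) * X) =
        (1 + C (x i * a) * X) * (C (x m) * ∏ j ∈ M.erase m,
          (1 + C (x j * if j < m then a else b) * X)) := by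
      intro m hm
      rw [erase_insert_of_ne (hne m hm), prod_insert (fun h => hiM (mem_of_mem_erase h)),
        if_pos (hi m hm)]
      ring
    rw [h₁, sum_congr rfl h₂, ← mul_sum, C_mul]
    ring

end PQDeriv

/-! ### Openers and children of a partition -/

section Partition

variable {n : ℕ}

lemma inSameBlock_iff (p : SetPartition n) (i j : Fin n) :
    InSameBlock p i j ↔ p.part i = p.part j := by
  rw [← p.mem_part_iff_part_eq_part (mem_univ i) (mem_univ j), p.mem_part_iff_exists]
  rfl

lemma isArc_iff (p : SetPartition n) (i j : Fin n) :
    IsArc p i j ↔ i < j ∧ p.part i = p.part j ∧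
      ∀ x, i < x → x < j → p.part i ≠ p.part x := by
  refine and_congr_right fun _ => ⟨?_, ?_⟩
  · rintro ⟨B, hB, hi, hj, h⟩
    obtain rfl := p.part_eq_of_mem hB hi
    refine ⟨(p.part_eq_of_mem hB hj).symm, fun x hx hxj he => h x ?_ ⟨hx, hxj⟩⟩
    rw [he]
    exact p.mem_part (mem_univ x)
  · rintro ⟨he, h⟩
    refine ⟨p.part i, p.part_mem.2 (mem_univ i), p.mem_part (mem_univ i),
      he ▸ p.mem_part (mem_univ j), fun x hx hlt => h x hlt.1 hlt.2 ?_⟩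
    exact (p.part_eq_of_mem (p.part_mem.2 (mem_univ i)) hx).symm

lemma SetPartition.ext_part {p q : SetPartition n}
    (h : ∀ i j, p.part i = p.part j ↔ q.part i = q.part j) : p = q := by
  have hpart : p.part = q.part := by
    funext i
    ext j
    rw [p.mem_part_iff_part_eq_part (mem_univ j) (mem_univ i),
      q.mem_part_iff_part_eq_part (mem_univ j) (mem_univ i), h]
  have hparts (r : SetPartition n) : r.parts = univ.image r.part := by
    ext B
    simp only [mem_image, mem_univ, true_and]
    constructor
    · intro hB
      obtain ⟨i, hi⟩ := r.nonempty_of_mem_parts hB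
      exact ⟨i, r.part_eq_of_mem hB hi⟩
    · rintro ⟨i, rfl⟩
      exact r.part_mem.2 (mem_univ i)
  exact Finpartition.ext (by rw [hparts p, hparts q, hpart])

/-- The openers of `p`, that is, the minimal elements of its blocks. -/
def openers (p : SetPartition n) : Finset (Fin n) :=
  {m | ∀ i, p.part i = p.part m → m ≤ i}

lemma mem_openers {p : SetPartition n} {m : Fin n} :
    m ∈ openers p ↔ ∀ i, p.part i = p.part m → m ≤ i := by
  simp [openers]

lemma eq_of_mem_openers {p : SetPartition n} {i j : Fin n} (hi : i ∈ openers p)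
    (hj : j ∈ openers p) (h : p.part i = p.part j) : i = j :=
  le_antisymm (mem_openers.1 hi j h.symm) (mem_openers.1 hj i h)

lemma exists_opener (p : SetPartition n) (i : Fin n) :
    ∃ m ∈ openers p, p.part m = p.part i := by
  have hne : (p.part i).Nonempty := ⟨i, p.mem_part (mem_univ i)⟩
  have key (k : Fin n) : k ∈ p.part i ↔ p.part k = p.part i :=
    p.mem_part_iff_part_eq_part (mem_univ k) (mem_univ i)
  have hm := (key _).1 (min'_mem _ hne)
  exact ⟨(p.part i).min' hne, mem_openers.2 fun k hk => min'_le _ _ ((key k).2 (hk.trans hm)), hm⟩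

lemma card_openers (p : SetPartition n) : #(openers p) = #p.parts := by
  refine card_bij (fun i _ => p.part i) (fun i _ => p.part_mem.2 (mem_univ i))
    (fun i hi j hj h => eq_of_mem_openers hi hj h) fun B hB => ?_
  obtain ⟨i, hi⟩ := p.nonempty_of_mem_parts hB
  obtain ⟨m, hm, h⟩ := exists_opener p i
  exact ⟨m, hm, h.trans (p.part_eq_of_mem hB hi)⟩

/-- The function whose fibres are the blocks of the child of `p` in which the new least element
joins the block of `m` (when `o = some m`) or is a singleton (when `o = none`). -/
def childKey (p : SetPartition n) (o : Option (Fin n)) : Fin (n + 1) → Option (Finset (Fin n)) :=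
  Fin.cons (o.map p.part) fun i => some (p.part i)

/-- The child of `p` in which the new least element joins the block of `m` (when `o = some m`) or
is a singleton (when `o = none`). -/
noncomputable def child (p : SetPartition n) (o : Option (Fin n)) : SetPartition (n + 1) :=
  open Classical in Finpartition.ofSetoid (Setoid.ker (childKey p o))

lemma child_part_eq (p : SetPartition n) (o : Option (Fin n)) (i j : Fin (n + 1)) :
    (child p o).part i = (child p o).part j ↔ childKey p o i = childKey p o j := by
  classical
  rw [← (child p o).mem_part_iff_part_eq_part (mem_univ i) (mem_univ j), child,
    Finpartition.mem_part_ofSetoid_iff_rel, Setoid.ker_def, eq_comm]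

lemma child_part_succ_succ (p : SetPartition n) (o : Option (Fin n)) (i j : Fin n) :
    (child p o).part i.succ = (child p o).part j.succ ↔ p.part i = p.part j := by
  simp [child_part_eq, childKey]

lemma child_none_part_zero_succ (p : SetPartition n) (j : Fin n) :
    ¬ (child p none).part 0 = (child p none).part j.succ := by
  simp [child_part_eq, childKey]

lemma child_some_part_zero_succ (p : SetPartition n) (m j : Fin n) :
    (child p (some m)).part 0 = (child p (some m)).part j.succ ↔ p.part m = p.part j := by
  simp [child_part_eq, childKey]

lemma isChild_iff (c : SetPartition (n + 1)) (p : SetPartition n) :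
    IsChild c p ↔ ∀ i j : Fin n, p.part i = p.part j ↔ c.part i.succ = c.part j.succ := by
  simp only [IsChild, inSameBlock_iff]

lemma isChild_iff_mem (c : SetPartition (n + 1)) (p : SetPartition n) :
    IsChild c p ↔ c ∈ (insertNone (openers p)).image (child p) := by
  rw [isChild_iff, mem_image]
  constructor
  · intro h
    by_cases h0 : ∃ j : Fin n, c.part 0 = c.part j.succ
    · obtain ⟨j, hj⟩ := h0
      obtain ⟨m, hm, hmj⟩ := exists_opener p j
      refine ⟨some m, some_mem_insertNone.2 hm, SetPartition.ext_part fun x y => ?_⟩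
      have h0m : c.part 0 = c.part m.succ := hj.trans ((h m j).1 hmj).symm
      have hz (k : Fin n) : (child p (some m)).part 0 = (child p (some m)).part k.succ ↔
          c.part 0 = c.part k.succ := by
        rw [child_some_part_zero_succ, h, h0m]
      cases x using Fin.cases <;> cases y using Fin.cases
      · simp
      · exact hz _
      · rw [eq_comm, hz, eq_comm]
      · rw [child_part_succ_succ, h]
    · push Not at h0
      refine ⟨none, none_mem_insertNone, SetPartition.ext_part fun x y => ?_⟩
      cases x using Fin.cases <;> cases y using Fin.cases
      · simp
      · exact iff_of_false (child_none_part_zero_succ p _) (h0 _)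
      · exact iff_of_false (fun h => child_none_part_zero_succ p _ h.symm) fun h => h0 _ h.symm
      · rw [child_part_succ_succ, h]
  · rintro ⟨o, -, rfl⟩ i j
    rw [child_part_succ_succ]

lemma child_injOn (p : SetPartition n) :
    Set.InjOn (child p) (insertNone (openers p) : Finset (Option (Fin n))) := by
  rintro (_ | m) ho (_ | m') ho' h
  · rfl
  · exact absurd (h ▸ (child_some_part_zero_succ p m' m').2 rfl) (child_none_part_zero_succ p m')
  · exact absurd (h ▸ (child_some_part_zero_succ p m m).2 rfl) (child_none_part_zero_succ p m)
  · have hm := (child_some_part_zero_succ p m' m').2 rfl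
    rw [← h, child_some_part_zero_succ] at hm
    rw [eq_of_mem_openers (some_mem_insertNone.1 ho) (some_mem_insertNone.1 ho') hm]

lemma zero_mem_openers (c : SetPartition (n + 1)) : 0 ∈ openers c :=
  mem_openers.2 fun i _ => Fin.zero_le i

lemma succ_mem_openers_child {p : SetPartition n} {o : Option (Fin n)} {j : Fin n} :
    j.succ ∈ openers (child p o) ↔
      j ∈ openers p ∧ ¬ (child p o).part 0 = (child p o).part j.succ := by
  rw [mem_openers, Fin.forall_fin_succ, mem_openers]
  simp only [child_part_succ_succ, Fin.succ_le_succ_iff, Fin.le_zero_iff, Fin.succ_ne_zero,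
    imp_false]
  exact and_comm

lemma openers_child_none (p : SetPartition n) :
    openers (child p none) = insert 0 ((openers p).map (Fin.succEmb n)) := by
  ext x
  cases x using Fin.cases with
  | zero => simp [zero_mem_openers]
  | succ j => simp [succ_mem_openers_child, child_none_part_zero_succ]

lemma openers_child_some {p : SetPartition n} {m : Fin n} (hm : m ∈ openers p) :
    openers (child p (some m)) = insert 0 (((openers p).erase m).map (Fin.succEmb n)) := by
  ext x
  cases x using Fin.cases with
  | zero => simp [zero_mem_openers]
  | succ j =>
    simp only [succ_mem_openers_child, child_some_part_zero_succ, mem_insert, Fin.succ_ne_zero,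
      mem_map, mem_erase, Fin.coe_succEmb, Fin.succ_inj, exists_eq_right, false_or]
    constructor
    · rintro ⟨hj, h⟩
      exact ⟨fun he => h (by rw [he]), hj⟩
    · rintro ⟨hne, hj⟩
      exact ⟨hj, fun h => hne (eq_of_mem_openers hm hj h).symm⟩

/-- The finset of arcs of `p`. -/
noncomputable def arcs (p : SetPartition n) : Finset (Fin n × Fin n) :=
  open Classical in {e | IsArc p e.1 e.2}

lemma mem_arcs {p : SetPartition n} {e : Fin n × Fin n} : e ∈ arcs p ↔ IsArc p e.1 e.2 := by
  simp [arcs]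

/-- Shift both ends of an arc up by one. -/
def arcSucc (n : ℕ) : Fin n × Fin n ↪ Fin (n + 1) × Fin (n + 1) :=
  (Fin.succEmb n).prodMap (Fin.succEmb n)

@[simp] lemma arcSucc_apply (e : Fin n × Fin n) : arcSucc n e = (e.1.succ, e.2.succ) := rfl

lemma isArc_child_succ_succ (p : SetPartition n) (o : Option (Fin n)) (i j : Fin n) :
    IsArc (child p o) i.succ j.succ ↔ IsArc p i j := by
  rw [isArc_iff, isArc_iff, Fin.forall_fin_succ]
  simp [child_part_succ_succ]

lemma not_isArc_zero (c : SetPartition (n + 1)) (i : Fin (n + 1)) : ¬ IsArc c i 0 :=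
  fun h => Fin.not_lt_zero i h.1

lemma arcs_child_none (p : SetPartition n) :
    arcs (child p none) = (arcs p).map (arcSucc n) := by
  ext ⟨x, y⟩
  cases x using Fin.cases <;> cases y using Fin.cases
  · simp [mem_arcs, not_isArc_zero]
  · simp [mem_arcs, isArc_iff, child_none_part_zero_succ]
  · simp [mem_arcs, not_isArc_zero]
  · simp [mem_arcs, isArc_child_succ_succ]

lemma arcs_child_some {p : SetPartition n} {m : Fin n} (hm : m ∈ openers p) :
    arcs (child p (some m)) = insert (0, m.succ) ((arcs p).map (arcSucc n)) := by
  ext ⟨x, y⟩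
  cases x using Fin.cases <;> cases y using Fin.cases
  · simp [mem_arcs, not_isArc_zero, (Fin.succ_ne_zero m).symm]
  · rename_i j
    have : IsArc (child p (some m)) 0 j.succ ↔ j = m := by
      rw [isArc_iff, Fin.forall_fin_succ]
      simp only [Fin.succ_pos, child_some_part_zero_succ, Fin.succ_lt_succ_iff, lt_irrefl,
        IsEmpty.forall_iff, true_and, forall_const, ne_eq]
      constructor
      · rintro ⟨h, h'⟩
        refine le_antisymm (not_lt.1 fun hlt => h' m hlt rfl) (mem_openers.1 hm j h.symm)
      · rintro rfl
        exact ⟨rfl, fun x hx h => (mem_openers.1 hm x h.symm).not_gt hx⟩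
    simp [mem_arcs, this]
  · simp [mem_arcs, not_isArc_zero]
  · simp [mem_arcs, isArc_child_succ_succ]

end Partition

/-! ### The statistic on children -/

section Statistic

variable {G : Type*} [AddCommGroup G] (α β : G) {n : ℕ}

/-- The contribution of the ordered pair of arcs `(e, f)` to `s_{α,β}`. -/
def pairWeight (e f : Fin n × Fin n) : G :=
  if e.1 < f.1 ∧ f.1 < e.2 ∧ e.2 < f.2 then α
  else if e.1 < f.1 ∧ f.1 < f.2 ∧ f.2 < e.2 then β else 0

/-- The contribution to `s_{α,β}` of an arc to `j` from a new least element paired with the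
arc `e`. -/
def arcWeight (j : Fin n) (e : Fin n × Fin n) : G :=
  if e.1 < j ∧ j < e.2 then α else if e.2 < j then β else 0

/-- The increment of `s_{α,β}` when a new least element is joined to the opener `j`. -/
noncomputable def increment (p : SetPartition n) (j : Fin n) : G :=
  ∑ e ∈ arcs p, arcWeight α β j e

lemma statS_eq_sum (p : SetPartition n) :
    statS α β p = ∑ e ∈ arcs p, ∑ f ∈ arcs p, pairWeight α β e f := by
  classical
  have hcard (P : Fin n × Fin n → Fin n × Fin n → Prop) (γ : G) :
      {e : (Fin n × Fin n) × (Fin n × Fin n) |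
        IsArc p e.1.1 e.1.2 ∧ IsArc p e.2.1 e.2.2 ∧ P e.1 e.2}.ncard • γ =
      ∑ e ∈ arcs p, ∑ f ∈ arcs p, if P e f then γ else 0 := by
    rw [← sum_product' (f := fun e f => if P e f then γ else 0), ← sum_filter, sum_const,
      ← Set.ncard_coe_finset]
    congr 2
    ext e
    simp [mem_arcs, and_assoc]
  rw [statS, cr, ne', hcard, hcard, ← sum_add_distrib]
  refine sum_congr rfl fun e _ => ?_
  rw [← sum_add_distrib]
  refine sum_congr rfl fun f _ => ?_
  unfold pairWeight Crossing Nesting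
  split_ifs <;> first | omega | simp

lemma pairWeight_arcSucc (e f : Fin n × Fin n) :
    pairWeight α β (arcSucc n e) (arcSucc n f) = pairWeight α β e f := by
  simp [pairWeight]

lemma pairWeight_zero_right (e : Fin (n + 1) × Fin (n + 1)) (j : Fin (n + 1)) :
    pairWeight α β e (0, j) = 0 := by
  simp [pairWeight]

lemma pairWeight_zero_left {p : SetPartition n} {e : Fin n × Fin n} (he : e ∈ arcs p)
    (j : Fin n) : pairWeight α β (0, j.succ) (arcSucc n e) = arcWeight α β j e := by
  simp [pairWeight, arcWeight, (mem_arcs.1 he).1]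

lemma arcWeight_arcSucc (e : Fin n × Fin n) (j : Fin n) :
    arcWeight α β j.succ (arcSucc n e) = arcWeight α β j e := by
  simp [arcWeight]

lemma zero_arc_notMem (m : Fin n) (A : Finset (Fin n × Fin n)) :
    (0, m.succ) ∉ A.map (arcSucc n) := by
  simp

lemma statS_child_none (p : SetPartition n) : statS α β (child p none) = statS α β p := by
  simp only [statS_eq_sum, arcs_child_none, sum_map, pairWeight_arcSucc]

lemma statS_child_some {p : SetPartition n} {m : Fin n} (hm : m ∈ openers p) :
    statS α β (child p (some m)) = statS α β p + increment α β p m := by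
  simp only [statS_eq_sum, arcs_child_some hm, sum_insert (zero_arc_notMem _ _), sum_map,
    pairWeight_arcSucc, pairWeight_zero_right, zero_add]
  rw [add_comm, increment, sum_congr rfl fun e he => pairWeight_zero_left α β he m]

lemma increment_zero (c : SetPartition (n + 1)) : increment α β c 0 = 0 := by
  simp [increment, arcWeight]

lemma increment_child_none (p : SetPartition n) (j : Fin n) :
    increment α β (child p none) j.succ = increment α β p j := by
  simp only [increment, arcs_child_none, sum_map, arcWeight_arcSucc]

lemma increment_child_some {p : SetPartition n} {m j : Fin n} (hm : m ∈ openers p)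
    (hj : j ≠ m) : increment α β (child p (some m)) j.succ =
      increment α β p j + if j < m then α else β := by
  simp only [increment, arcs_child_some hm, sum_insert (zero_arc_notMem _ _), sum_map,
    arcWeight_arcSucc]
  rw [add_comm]
  rcases hj.lt_or_gt with h | h
  · simp [arcWeight, h]
  · simp [arcWeight, h, h.not_gt]

end Statistic

/-! ### Generating functions over the levels of a subtree -/

section GeneratingFunction

open Polynomial

variable {n : ℕ}

/-- The children of `p`. -/
noncomputable def children (p : SetPartition n) : Finset (SetPartition (n + 1)) :=
  (insertNone (openers p)).image (child p)

lemma mem_children {p : SetPartition n} {c : SetPartition (n + 1)} :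
    c ∈ children p ↔ IsChild c p :=
  (isChild_iff_mem c p).symm

lemma sum_children {M : Type*} [AddCommMonoid M] (p : SetPartition n)
    (f : SetPartition (n + 1) → M) :
    ∑ c ∈ children p, f c = f (child p none) + ∑ m ∈ openers p, f (child p (some m)) := by
  rw [children, sum_image (child_injOn p), sum_insertNone]

/-- The level `T(p, l)` as a finset. -/
noncomputable def levelFinset (p : SetPartition n) : (l : ℕ) → Finset (SetPartition (n + l))
  | 0 => {p}
  | l + 1 => (levelFinset p l).biUnion children

lemma mem_levelFinset {p : SetPartition n} {l : ℕ} {t : SetPartition (n + l)} :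
    t ∈ levelFinset p l ↔ t ∈ level p l := by
  induction l with
  | zero => simp [levelFinset, level]
  | succ l ih => simp [levelFinset, level, mem_children, ih]

lemma sum_levelFinset_succ {M : Type*} [AddCommMonoid M] (p : SetPartition n) (l : ℕ)
    (f : SetPartition (n + (l + 1)) → M) :
    ∑ c ∈ levelFinset p (l + 1), f c = ∑ q ∈ levelFinset p l, ∑ c ∈ children q, f c := by
  refine sum_biUnion fun q _ q' _ hne => disjoint_left.2 fun c hc hc' => hne ?_
  rw [mem_children, isChild_iff] at hc hc'
  exact SetPartition.ext_part fun i j => (hc i j).trans (hc' i j).symm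

variable {G : Type*} [AddCommGroup G] (α β : G)

/-- The monomial recording the value of `s_{α,β}` and the number of blocks. -/
noncomputable def mono (g : G) (m : ℕ) : AddMonoidAlgebra ℕ (G × ℕ) :=
  AddMonoidAlgebra.single (g, m) 1

lemma mono_mul_mono (g g' : G) (m m' : ℕ) :
    mono g m * mono g' m' = mono (g + g') (m + m') := by
  simp [mono, AddMonoidAlgebra.single_mul_single]

lemma mono_zero : mono (0 : G) 0 = 1 := rfl

/-- The polynomial whose coefficients are the elementary symmetric functions in the increments
of `p`. -/
noncomputable def incrementPoly (p : SetPartition n) : (AddMonoidAlgebra ℕ (G × ℕ))[X] :=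
  ∏ m ∈ openers p, (1 + C (mono (increment α β p m) 0) * X)

lemma incrementPoly_child_none (p : SetPartition n) :
    incrementPoly α β (child p none) = (1 + X) * incrementPoly α β p := by
  rw [incrementPoly, openers_child_none, prod_insert (by simp), prod_map]
  simp [increment_zero, increment_child_none, incrementPoly, mono_zero]

lemma incrementPoly_child_some {p : SetPartition n} {m : Fin n} (hm : m ∈ openers p) :
    incrementPoly α β (child p (some m)) = (1 + X) * ∏ j ∈ (openers p).erase m,
      (1 + C (mono (increment α β p j) 0 * if j < m then mono α 0 else mono β 0) * X) := by
  rw [incrementPoly, openers_child_some hm, prod_insert (by simp), prod_map, increment_zero,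
    mono_zero, C_1, one_mul]
  refine congrArg _ (prod_congr rfl fun j hj => ?_)
  rw [Fin.coe_succEmb, increment_child_some α β hm (ne_of_mem_erase hj)]
  split_ifs <;> rw [mono_mul_mono]

lemma card_openers_child_none (p : SetPartition n) :
    #(openers (child p none)) = #(openers p) + 1 := by
  rw [openers_child_none, card_insert_of_notMem (by simp), card_map]

lemma card_openers_child_some {p : SetPartition n} {m : Fin n} (hm : m ∈ openers p) :
    #(openers (child p (some m))) = #(openers p) := by
  rw [openers_child_some hm, card_insert_of_notMem (by simp), card_map, card_erase_add_one hm]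

/-- The functionals turning `incrementPoly` into the generating functions of the levels. -/
noncomputable def levelFunctional :
    ℕ → (AddMonoidAlgebra ℕ (G × ℕ))[X] →ₗ[AddMonoidAlgebra ℕ (G × ℕ)] AddMonoidAlgebra ℕ (G × ℕ)
  | 0 => Polynomial.lcoeff _ 0
  | l + 1 =>
    mono (0 : G) 1 • levelFunctional l ∘ₗ LinearMap.mulLeft _ (1 + X) +
      levelFunctional l ∘ₗ LinearMap.mulLeft _ (1 + X) ∘ₗ pqDeriv (mono α 0) (mono β 0)

/-- The generating function of the level `T(p, l)`, in closed form. -/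
noncomputable def levelGen (l : ℕ) (p : SetPartition n) : AddMonoidAlgebra ℕ (G × ℕ) :=
  mono (statS α β p) #(openers p) * levelFunctional α β l (incrementPoly α β p)

lemma levelGen_zero (p : SetPartition n) :
    levelGen α β 0 p = mono (statS α β p) #(openers p) := by
  simp [levelGen, levelFunctional, incrementPoly, coeff_zero_prod]

lemma sum_children_levelGen (l : ℕ) (p : SetPartition n) :
    ∑ c ∈ children p, levelGen α β l c = levelGen α β (l + 1) p := by
  have hsome : ∀ m ∈ openers p, levelGen α β l (child p (some m)) =
      mono (statS α β p) #(openers p) * levelFunctional α β l ((1 + X) *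
        (C (mono (increment α β p m) 0) * ∏ j ∈ (openers p).erase m,
          (1 + C (mono (increment α β p j) 0 * if j < m then mono α 0 else mono β 0) * X))) := by
    intro m hm
    have hcomm (x : AddMonoidAlgebra ℕ (G × ℕ)) (Q : (AddMonoidAlgebra ℕ (G × ℕ))[X]) :
        (1 + X) * (C x * Q) = x • ((1 + X) * Q) := by
      rw [smul_eq_C_mul]
      ring
    rw [levelGen, card_openers_child_some hm, statS_child_some α β hm,
      incrementPoly_child_some α β hm, hcomm, map_smul,
      smul_eq_mul, ← mul_assoc, mono_mul_mono, add_zero]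
  rw [sum_children, sum_congr rfl hsome, ← mul_sum, ← map_sum, ← mul_sum,
    ← pqDeriv_prod (mono α 0) (mono β 0) (openers p) fun m => mono (increment α β p m) 0]
  rw [levelGen, card_openers_child_none, statS_child_none, incrementPoly_child_none, levelGen,
    ← add_zero (statS α β p), ← mono_mul_mono, add_zero, mul_assoc, ← mul_add]
  rfl

lemma sum_levelFinset_levelGen (p : SetPartition n) (l k : ℕ) :
    ∑ t ∈ levelFinset p l, levelGen α β k t = levelGen α β (l + k) p := by
  induction l generalizing k with
  | zero => simp [levelFinset]
  | succ l ih =>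
    rw [sum_levelFinset_succ]
    simp only [sum_children_levelGen]
    rw [ih, add_right_comm, add_assoc]

lemma coeff_levelGen (p : SetPartition n) (l m : ℕ) (g : G) :
    (levelGen α β l p).coeff (g, m) =
      {t ∈ level p l | #t.parts = m ∧ statS α β t = g}.ncard := by
  classical
  have hset : {t ∈ level p l | #t.parts = m ∧ statS α β t = g} =
      ({t ∈ levelFinset p l | (statS α β t, #(openers t)) = (g, m)} : Finset _) := by
    ext t
    simp [mem_levelFinset, card_openers, and_comm]
  rw [hset, Set.ncard_coe_finset, card_filter, ← add_zero l, ← sum_levelFinset_levelGen,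
    AddMonoidAlgebra.coeff_sum, Finsupp.finsetSum_apply]
  refine sum_congr rfl fun t _ => ?_
  rw [levelGen_zero, mono, AddMonoidAlgebra.coeff_single, Finsupp.single_apply]

lemma count_map_statS (p : SetPartition n) (l : ℕ) (g : G) [DecidableEq G] :
    ((levelFinset p l).val.map (statS α β)).count g =
      {t ∈ level p l | statS α β t = g}.ncard := by
  have hset : {t ∈ level p l | statS α β t = g} =
      ({t ∈ levelFinset p l | g = statS α β t} : Finset _) := by
    ext t
    simp [mem_levelFinset, eq_comm]
  rw [hset, Set.ncard_coe_finset, Multiset.count_map]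
  rfl

lemma map_statS_levelFinset_one (p : SetPartition n) :
    (levelFinset p 1).val.map (statS α β) =
      statS α β p ::ₘ ((openers p).val.map (increment α β p)).map (statS α β p + ·) := by
  have hs {ι : Type} (s : Finset ι) (f : ι → G) :
      ∑ c ∈ s, ({f c} : Multiset G) = s.val.map f := by
    rw [← Multiset.sum_map_singleton (s.val.map f), Multiset.map_map]
    rfl
  have h := sum_levelFinset_succ p 0 fun c => ({statS α β c} : Multiset G)
  rw [levelFinset, sum_singleton, sum_children, statS_child_none,
    sum_congr (s₁ := openers p) rfl fun m hm => by rw [statS_child_some α β hm], hs, hs] at h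
  rw [Multiset.map_map, ← Multiset.singleton_add]
  exact h

end GeneratingFunction

/-- Theorem 1.1(a). If the multiset of values of `s_{α,β}` agrees on
levels `0` and `1` of the trees rooted at the nonempty partitions `lam` and `pi`, then it
agrees on `T(lam,l,m)` and `T(pi,l,m)` for all `l, m ≥ 0`. Multiset equality is expressed
by equality of the number of elements attaining each value `g : G`. -/
theorem statement0 {G : Type*} [AddCommGroup G] (α β : G) {n n' : ℕ}
    (hn : 0 < n) (hn' : 0 < n') (lam : SetPartition n) (pi : SetPartition n')
    (h : ∀ l ≤ 1, ∀ g : G,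
      {t ∈ level lam l | statS α β t = g}.ncard =
      {t ∈ level pi l | statS α β t = g}.ncard) :
    ∀ l m : ℕ, ∀ g : G,
      {t ∈ level lam l | t.parts.card = m ∧ statS α β t = g}.ncard =
      {t ∈ level pi l | t.parts.card = m ∧ statS α β t = g}.ncard := by
  classical
  have h01 : ∀ l ≤ 1, (levelFinset lam l).val.map (statS α β) =
      (levelFinset pi l).val.map (statS α β) := by
    intro l hl
    ext g
    rw [count_map_statS, count_map_statS, h l hl g]
  have h0 : statS α β lam = statS α β pi := by
    simpa [levelFinset] using h01 0 zero_le_one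
  have h1 := h01 1 le_rfl
  rw [map_statS_levelFinset_one, map_statS_levelFinset_one, h0, Multiset.cons_inj_right] at h1
  replace h1 := Multiset.map_injective (add_right_injective (statS α β pi)) h1
  have hcard : #(openers lam) = #(openers pi) := by
    simpa using congrArg Multiset.card h1
  have hpoly : incrementPoly α β lam = incrementPoly α β pi := by
    have := congrArg (fun s => (s.map fun d =>
      1 + Polynomial.C (mono d 0) * Polynomial.X).prod) h1
    rw [Multiset.map_map, Multiset.map_map] at this
    exact this
  intro l m g
  rw [← coeff_levelGen, ← coeff_levelGen, levelGen, levelGen, h0, hcard, hpoly]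
end

section
/- Let G be an abelian group and let X and Y be finite multisets of finite nonempty sequences over G such that f_γ^r(X) = f_γ^r(Y) for every integer r ≥ 0 and every γ ∈ G. Then f_γ^r(M(X)) = f_γ^r(M(Y)) for every r ≥ 0 and every γ ∈ G. -/
variable {G : Type*} [AddCommGroup G]

/-- `f_γ^r(x₁…x_l)`: the multiset
`{x_{a₁} + ⋯ + x_{a_r} − (r−1)x₁ + γ : 1 < a₁ < ⋯ < a_r ≤ l}`, with one element for each
choice of `r` positions strictly after the first. -/
def fStat (γ : G) (r : ℕ) (w : List G) : Multiset G :=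
  ((w.tail.sublistsLen r).map fun c => c.sum - ((r : ℤ) - 1) • w.headD 0 + γ : List G)

/-- The extension of `f_γ^r` to finite multisets of sequences, adding multiplicities. -/
def fStatM (γ : G) (r : ℕ) (X : Multiset (List G)) : Multiset G :=
  X.bind (fStat γ r)

/-- The operator `M(x₁x₂…x_l) = x₁x₁x₂…x_l`. -/
def Mop : List G → List G
  | [] => []
  | x :: t => x :: x :: t

/-- The extension of `M` to finite multisets of sequences. -/
def MopM (X : Multiset (List G)) : Multiset (List G) :=
  X.map Mop

/-- `R_{α,β,i}` (here `i` is 0-indexed: `RopAt α β w i` with `0 ≤ i < l` is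
`R_{α,β,i+1}(x₁…x_l) = x_{i+1}(x₁…x_i + (x_{i+1}−x₁+α))(x_{i+2}…x_l + (x_{i+1}−x₁+β))`,
where adding a group element to a sequence adds it to every term). -/
def RopAt (α β : G) (w : List G) (i : ℕ) : List G :=
  w.getD i 0 ::
    ((w.take i).map (· + (w.getD i 0 - w.headD 0 + α)) ++
      (w.drop (i + 1)).map (· + (w.getD i 0 - w.headD 0 + β)))

/-- `R_{α,β}(w)`: the multiset `{R_{α,β,i}(w) : 1 ≤ i ≤ l}`. -/
def Rop (α β : G) (w : List G) : Multiset (List G) :=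
  ((List.range w.length).map (RopAt α β w) : List (List G))

/-- The extension of `R_{α,β}` to finite multisets of sequences. -/
def RopM (α β : G) (X : Multiset (List G)) : Multiset (List G) :=
  X.bind (Rop α β)


theorem fStat_zero_Mop (γ : G) (w : List G) : fStat γ 0 (Mop w) = fStat γ 0 w := by
  cases w <;> simp [fStat, Mop]

theorem fStat_succ_Mop (γ : G) (r : ℕ) {w : List G} (hw : w ≠ []) :
    fStat γ (r + 1) (Mop w) = fStat γ (r + 1) w + fStat γ r w := by
  cases w with
  | nil => exact absurd rfl hw
  | cons x t =>
    simp only [fStat, Mop, List.tail_cons, List.sublistsLen_succ_cons, List.map_append,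
      List.map_map, ← Multiset.coe_add, List.headD_cons]
    congr 2
    refine List.map_congr_left fun c _ => ?_
    simp only [Function.comp_apply, List.sum_cons, Nat.cast_add, Nat.cast_one, sub_smul, add_smul,
      one_smul]
    abel

theorem fStatM_zero_MopM (γ : G) (X : Multiset (List G)) :
    fStatM γ 0 (MopM X) = fStatM γ 0 X := by
  simp only [fStatM, MopM, Multiset.bind_map, fStat_zero_Mop]

theorem fStatM_succ_MopM (γ : G) (r : ℕ) {X : Multiset (List G)} (hX : ∀ w ∈ X, w ≠ []) :
    fStatM γ (r + 1) (MopM X) = fStatM γ (r + 1) X + fStatM γ r X := by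
  simp only [fStatM, MopM, Multiset.bind_map, ← Multiset.bind_add]
  exact Multiset.bind_congr fun w hw => fStat_succ_Mop γ r (hX w hw)

/-- Lemma 2.3(a). If `f_γ^r(X) = f_γ^r(Y)` for all `r ≥ 0` and `γ ∈ G`,
then `f_γ^r(M(X)) = f_γ^r(M(Y))` for all `r ≥ 0` and `γ ∈ G`. -/
theorem statement3 (X Y : Multiset (List G))
    (hX : ∀ w ∈ X, w ≠ []) (hY : ∀ w ∈ Y, w ≠ [])
    (h : ∀ (r : ℕ) (γ : G), fStatM γ r X = fStatM γ r Y) :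
    ∀ (r : ℕ) (γ : G), fStatM γ r (MopM X) = fStatM γ r (MopM Y) := by
  intro r γ
  cases r with
  | zero => rw [fStatM_zero_MopM, fStatM_zero_MopM, h]
  | succ r => rw [fStatM_succ_MopM γ r hX, fStatM_succ_MopM γ r hY, h, h]
end

section
/- Let G be an abelian group, let α, β ∈ G, and let X and Y be finite multisets of finite nonempty sequences over G such that f_γ^r(X) = f_γ^r(Y) for every integer r ≥ 0 and every γ ∈ G. Then f_γ^r(R_{α,β}(X)) = f_γ^r(R_{α,β}(Y)) for every r ≥ 0 and every γ ∈ G. -/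
variable {G : Type*} [AddCommGroup G]

/-- The multiset of sums of the `r`-element submultisets of `s`, each translated by `c`. -/
def subsetSums (c : G) (r : ℕ) (s : Multiset G) : Multiset G :=
  (s.powersetCard r).map fun t => t.sum + c

theorem subsetSums_zero (c : G) (s : Multiset G) : subsetSums c 0 s = {c} := by
  simp [subsetSums]

theorem subsetSums_succ_zero (c : G) (r : ℕ) : subsetSums c (r + 1) 0 = 0 := by
  simp [subsetSums, Multiset.powersetCard_zero_right]

theorem subsetSums_succ_cons (c a : G) (r : ℕ) (s : Multiset G) :
    subsetSums c (r + 1) (a ::ₘ s) = subsetSums c (r + 1) s + subsetSums (c + a) r s := by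
  simp only [subsetSums, Multiset.powersetCard_cons, Multiset.map_add, Multiset.map_map,
    Function.comp_def, Multiset.sum_cons]
  congr 1
  exact Multiset.map_congr rfl fun t _ => by abel

theorem subsetSums_map_add (c b : G) (r : ℕ) (s : Multiset G) :
    subsetSums c r (s.map (· + b)) = subsetSums (c + r • b) r s := by
  simp only [subsetSums, Multiset.powersetCard_map, Multiset.map_map, Function.comp_def]
  refine Multiset.map_congr rfl fun t ht => ?_
  rw [Multiset.sum_map_add, Multiset.map_const', Multiset.sum_replicate,
    (Multiset.mem_powersetCard.mp ht).2, Multiset.map_id']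
  abel

/-- Choosing a position `i` and `r` further positions, shifted by `α` before `i` and by `β` after
it, amounts to choosing `r + 1` positions and the rank of `i` among them. -/
theorem sum_subsetSums_take_drop (α β : G) (t : List G) (c : G) (r : ℕ) :
    ∑ i ∈ Finset.range t.length, subsetSums (c + t.getD i 0) r
        ((t.take i).map (· + α) ++ (t.drop (i + 1)).map (· + β) : List G) =
      ∑ p ∈ Finset.HasAntidiagonal.antidiagonal r,
        subsetSums (c + p.1 • α + p.2 • β) (r + 1) (t : Multiset G) := by
  induction t generalizing c r with
  | nil => simp [subsetSums_succ_zero]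
  | cons a t ih =>
    rw [List.length_cons, Finset.sum_range_succ']
    simp only [List.getD_cons_succ, List.take_succ_cons, List.drop_succ_cons, List.map_cons,
      List.cons_append, List.getD_cons_zero, List.take_zero, List.map_nil, List.nil_append,
      List.drop_zero, ← Multiset.cons_coe, zero_add]
    rw [← Multiset.map_coe, subsetSums_map_add]
    simp only [subsetSums_succ_cons, Finset.sum_add_distrib]
    rw [← ih]
    cases r with
    | zero => simp [subsetSums_zero]
    | succ r =>
      simp only [subsetSums_succ_cons, Finset.sum_add_distrib]
      rw [Finset.Nat.sum_antidiagonal_succ, add_assoc]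
      congr 1
      rw [add_comm]
      congr 1
      · congr 1
        simp only [zero_nsmul]
        abel
      · have key := ih (c + a + α) r
        convert key using 3 with i _ p _
        · abel
        · rw [succ_nsmul]
          abel

theorem fStat_cons_map_add (γ y : G) (r : ℕ) (t : List G) :
    fStat γ r (y :: t.map (· + y)) = subsetSums (γ + y) r t := by
  have h : fStat γ r (y :: t.map (· + y)) =
      subsetSums (γ - ((r : ℤ) - 1) • y) r (t.map (· + y) : List G) := by
    simp only [fStat, subsetSums, List.tail_cons, List.headD_cons, Multiset.powersetCard_coe,
      Multiset.map_coe, List.map_map, Function.comp_def, Multiset.sum_coe]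
    congr 2
    funext s
    abel
  rw [h, ← Multiset.map_coe, subsetSums_map_add]
  congr 1
  rw [sub_smul, natCast_zsmul, one_smul]
  abel

theorem fStat_cons (γ x : G) (r : ℕ) (u : List G) :
    fStat γ r (x :: u) = subsetSums (γ + x) r (u.map (· - x) : List G) := by
  rw [← fStat_cons_map_add]
  simp [Function.comp_def]

theorem fStat_RopAt (α β γ x : G) (r i : ℕ) (u : List G) (hi : i < (x :: u).length) :
    fStat γ r (RopAt α β (x :: u) i) =
      subsetSums (γ + x + ((x :: u).map (· - x)).getD i 0) r
        ((((x :: u).map (· - x)).take i).map (· + α) ++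
          (((x :: u).map (· - x)).drop (i + 1)).map (· + β) : List G) := by
  have hy : (x :: u).getD i 0 = x + ((x :: u).map (· - x)).getD i 0 := by
    rw [List.getD_eq_getElem _ _ hi, List.getD_eq_getElem _ _ (by simpa using hi),
      List.getElem_map]
    abel
  rw [add_assoc, ← hy, ← fStat_cons_map_add, RopAt, List.headD_cons]
  congr 2
  rw [List.map_append, ← List.map_take, ← List.map_drop]
  simp only [List.map_map]
  congr 2 <;> (funext z; simp only [Function.comp_apply]; abel)

theorem fStatM_Rop (α β γ : G) (r : ℕ) {w : List G} (hw : w ≠ []) :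
    fStatM γ r (Rop α β w) = ∑ p ∈ Finset.HasAntidiagonal.antidiagonal r,
      (fStat (γ + p.1 • α + p.2 • β) (r + 1) w + fStat (γ + p.1 • α + p.2 • β) r w) := by
  obtain ⟨x, u, rfl⟩ := List.exists_cons_of_ne_nil hw
  have h : fStatM γ r (Rop α β (x :: u)) =
      ∑ i ∈ Finset.range (x :: u).length, fStat γ r (RopAt α β (x :: u) i) := by
    simp only [fStatM, Rop, ← Multiset.map_coe, Multiset.bind_map]
    rfl
  have hlen : (x :: u).length = ((x :: u).map (· - x)).length := by simp
  rw [h, Finset.sum_congr rfl fun i hi => fStat_RopAt α β γ x r i u (Finset.mem_range.mp hi),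
    hlen, sum_subsetSums_take_drop]
  refine Finset.sum_congr rfl fun p _ => ?_
  rw [List.map_cons, ← Multiset.cons_coe, subsetSums_succ_cons, sub_self, add_zero,
    fStat_cons, fStat_cons]
  have hc : γ + x + p.1 • α + p.2 • β = γ + p.1 • α + p.2 • β + x := by abel
  rw [hc]

theorem fStatM_RopM (α β γ : G) (r : ℕ) {X : Multiset (List G)} (hX : ∀ w ∈ X, w ≠ []) :
    fStatM γ r (RopM α β X) = ∑ p ∈ Finset.HasAntidiagonal.antidiagonal r,
      (fStatM (γ + p.1 • α + p.2 • β) (r + 1) X + fStatM (γ + p.1 • α + p.2 • β) r X) := by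
  have h : fStatM γ r (RopM α β X) = X.bind fun w => fStatM γ r (Rop α β w) :=
    Multiset.bind_assoc
  rw [h, Multiset.bind_congr fun w hw => fStatM_Rop α β γ r (hX w hw)]
  simp only [fStatM, ← Multiset.bind_add]
  exact Multiset.sum_map_sum

/-- Lemma 2.3(b). If `f_γ^r(X) = f_γ^r(Y)` for all `r ≥ 0` and `γ ∈ G`,
then `f_γ^r(R_{α,β}(X)) = f_γ^r(R_{α,β}(Y))` for all `r ≥ 0` and `γ ∈ G`. -/
theorem statement4 (α β : G) (X Y : Multiset (List G))
    (hX : ∀ w ∈ X, w ≠ []) (hY : ∀ w ∈ Y, w ≠ [])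
    (h : ∀ (r : ℕ) (γ : G), fStatM γ r X = fStatM γ r Y) :
    ∀ (r : ℕ) (γ : G), fStatM γ r (RopM α β X) = fStatM γ r (RopM α β Y) := by
  intro r γ
  simp only [fStatM_RopM α β γ r hX, fStatM_RopM α β γ r hY, h]
end
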